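/- arXiv:1904.03440 — 2 statements merged into one kernel-verified Lean document; each statement's English description precedes it below -/
import Mathlib

section
/- Let φ : [0,∞) → [0,∞) and α : [0,∞) → [0,∞) be continuous and positive definite, let p : [0,∞) → [0,∞) be locally integrable and let θ > 0. Suppose that ∫_1^∞ ds/φ(s) = ∞ and inf_{a>0} ∫_{α(a)}^a ds/φ(s) > sup_{t≥0} ∫_t^{t+θ} p(s) ds. Then there exists ᾱ of class K∞ with α(a) ≤ ᾱ(a) for all a ≥ 0 such that inf_{a>0} ∫_{ᾱ(a)}^a ds/φ(s) > sup_{t≥0} ∫_t^{t+θ} p(s) ds. -/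
open MeasureTheory Filter Set
open scoped Classical

noncomputable section

/-- State/input spaces: `ℝ^k` with the Euclidean norm. -/
abbrev Stt (k : ℕ) : Type := EuclideanSpace ℝ (Fin k)

/-- An impulse-time sequence, identified with its (locally finite) set of impulse
times, a subset of `(0,∞)` with finitely many points below any bound. -/
def IsImpulseSeq (γ : Set ℝ) : Prop :=
  γ ⊆ Set.Ioi (0 : ℝ) ∧ ∀ T : ℝ, (γ ∩ Set.Iic T).Finite

/-- `n^γ_{(s,t]}`: the number of impulse times in the interval `(s,t]`. -/
def nJumps (γ : Set ℝ) (s t : ℝ) : ℕ := (γ ∩ Set.Ioc s t).ncard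

/-- Uniform incremental boundedness of a set of impulse-time sequences. -/
def UIB (S : Set (Set ℝ)) : Prop :=
  ∃ φ : ℝ → ℝ, ContinuousOn φ (Set.Ici 0) ∧ MonotoneOn φ (Set.Ici 0) ∧
    (∀ s : ℝ, 0 ≤ s → 0 ≤ φ s) ∧
    ∀ γ ∈ S, ∀ t0 t : ℝ, 0 ≤ t0 → t0 < t → (nJumps γ t0 t : ℝ) ≤ φ (t - t0)

/-- Class `K∞` functions `[0,∞) → [0,∞)`. -/
def ClassKInf (α : ℝ → ℝ) : Prop :=
  ContinuousOn α (Set.Ici 0) ∧ StrictMonoOn α (Set.Ici 0) ∧ α 0 = 0 ∧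
    ∀ M : ℝ, ∃ r : ℝ, 0 ≤ r ∧ M ≤ α r

/-- Class `KL` functions. -/
def ClassKL (β : ℝ → ℝ → ℝ) : Prop :=
  (∀ t : ℝ, 0 ≤ t → ClassKInf fun r => β r t) ∧
  ∀ r : ℝ, 0 ≤ r → AntitoneOn (fun t => β r t) (Set.Ici 0) ∧
    Filter.Tendsto (fun t => β r t) Filter.atTop (nhds 0)

/-- Positive definite functions `[0,∞) → [0,∞)`. -/
def PosDef (ρ : ℝ → ℝ) : Prop :=
  ContinuousOn ρ (Set.Ici 0) ∧ ρ 0 = 0 ∧ ∀ r : ℝ, 0 < r → 0 < ρ r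

/-- Locally integrable (on compacts) function `[0,∞) → ℝ` (extended to `ℝ`). -/
def LocIntegrable (p : ℝ → ℝ) : Prop :=
  ∀ a b : ℝ, MeasureTheory.IntegrableOn p (Set.Icc a b)

/-- Inputs: measurable, locally essentially bounded functions. -/
def IsInput {m : ℕ} (u : ℝ → Stt m) : Prop :=
  Measurable u ∧ ∀ T : ℝ, ∃ C : ℝ, ∀ᵐ t ∂MeasureTheory.volume, t ∈ Set.Icc 0 T → ‖u t‖ ≤ C

/-- `‖u_I‖_γ`: max of the essential supremum of `‖u‖` over `I` and the supremum of
`‖u‖` over `γ ∩ I`. -/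
def inputNorm {m : ℕ} (γ : Set ℝ) (u : ℝ → Stt m) (I : Set ℝ) : ℝ :=
  max (essSup (fun t => ‖u t‖) (MeasureTheory.volume.restrict I))
      (sSup ((fun t => ‖u t‖) '' (γ ∩ I)))

/-- Solution of the impulsive system `(γ,f,g)` on `[t0,T)` with initial state `x0`
and input `u` (Carathéodory solutions, in integral form, between impulses). -/
structure IsSolution {n m : ℕ} (γ : Set ℝ) (f g : ℝ → Stt n → Stt m → Stt n)
    (t0 : ℝ) (x0 : Stt n) (u : ℝ → Stt m) (T : EReal) (x : ℝ → Stt n) : Prop where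
  lt : (t0 : EReal) < T
  init : x t0 = x0
  flow : ∀ t1 t2 : ℝ, t0 ≤ t1 → t1 ≤ t2 → (t2 : EReal) < T → Set.Ioc t1 t2 ∩ γ = ∅ →
    MeasureTheory.IntegrableOn (fun s => f s (x s) (u s)) (Set.Icc t1 t2) ∧
    x t2 = x t1 + ∫ s in t1..t2, f s (x s) (u s)
  jump : ∀ t ∈ γ, t0 < t → (t : EReal) < T →
    ∃ L : Stt n, Filter.Tendsto x (nhdsWithin t (Set.Iio t)) (nhds L) ∧
      x t = L + g t L (u t)

/-- Maximally defined solution. -/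
def IsMaxSolution {n m : ℕ} (γ : Set ℝ) (f g : ℝ → Stt n → Stt m → Stt n)
    (t0 : ℝ) (x0 : Stt n) (u : ℝ → Stt m) (T : EReal) (x : ℝ → Stt n) : Prop :=
  IsSolution γ f g t0 x0 u T x ∧
    ∀ (T' : EReal) (x' : ℝ → Stt n), IsSolution γ f g t0 x0 u T' x' →
      (∀ t : ℝ, t0 ≤ t → (t : EReal) < T → x' t = x t) → T' ≤ T

/-- Weak `(h⁰,h)`-ISS of a parametrized family of impulsive systems. -/
def WeaklyISS {n m : ℕ} {Λ : Type*} (γ : Λ → Set ℝ)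
    (f g : Λ → ℝ → Stt n → Stt m → Stt n) (h0 h : ℝ → Stt n → ℝ) : Prop :=
  ∃ β : ℝ → ℝ → ℝ, ∃ ρ : ℝ → ℝ, ClassKL β ∧ ClassKInf ρ ∧
    ∀ (l : Λ) (t0 : ℝ) (x0 : Stt n) (u : ℝ → Stt m) (T : EReal) (x : ℝ → Stt n),
      0 ≤ t0 → IsInput u → IsMaxSolution (γ l) (f l) (g l) t0 x0 u T x →
      ∀ t : ℝ, t0 ≤ t → (t : EReal) < T →
        h t (x t) ≤ β (h0 t0 x0) (t - t0) + ρ (inputNorm (γ l) u (Set.Ioc t0 t))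

/-- Strong `(h⁰,h)`-ISS of a parametrized family of impulsive systems. -/
def StronglyISS {n m : ℕ} {Λ : Type*} (γ : Λ → Set ℝ)
    (f g : Λ → ℝ → Stt n → Stt m → Stt n) (h0 h : ℝ → Stt n → ℝ) : Prop :=
  ∃ β : ℝ → ℝ → ℝ, ∃ ρ : ℝ → ℝ, ClassKL β ∧ ClassKInf ρ ∧
    ∀ (l : Λ) (t0 : ℝ) (x0 : Stt n) (u : ℝ → Stt m) (T : EReal) (x : ℝ → Stt n),
      0 ≤ t0 → IsInput u → IsMaxSolution (γ l) (f l) (g l) t0 x0 u T x →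
      ∀ t : ℝ, t0 ≤ t → (t : EReal) < T →
        h t (x t) ≤ β (h0 t0 x0) (t - t0 + (nJumps (γ l) t0 t : ℝ)) +
          ρ (inputNorm (γ l) u (Set.Ioc t0 t))

/-- Locally Lipschitz on a set. -/
def LocLipschitzOn {α β : Type*} [PseudoEMetricSpace α] [PseudoEMetricSpace β]
    (s : Set α) (f : α → β) : Prop :=
  ∀ x ∈ s, ∃ K : NNReal, ∃ t ∈ nhdsWithin x s, LipschitzOnWith K f t

/-- `V ∈ V(γ)` with `Vm` its left-limit function at impulse times: `V` is locally
Lipschitz on each inter-impulse strip and has the joint left limit `Vm τ ξ`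
at each `τ ∈ γ`. -/
def InClassV {n : ℕ} (γ : Set ℝ) (V Vm : ℝ → Stt n → ℝ) : Prop :=
  (∀ a b : ℝ, 0 ≤ a → Set.Ioo a b ∩ γ = ∅ →
    LocLipschitzOn (Set.Ico a b ×ˢ (Set.univ : Set (Stt n)))
      (fun q : ℝ × Stt n => V q.1 q.2)) ∧
  ∀ τ ∈ γ, ∀ ξ : Stt n,
    Filter.Tendsto (fun q : ℝ × Stt n => V q.1 q.2)
      (nhdsWithin (τ, ξ) (Set.Iio τ ×ˢ (Set.univ : Set (Stt n)))) (nhds (Vm τ ξ))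

/-- Upper-right Dini derivative of `V` along the flow map `f`. -/
def DiniAlong {n m : ℕ} (f : ℝ → Stt n → Stt m → Stt n) (V : ℝ → Stt n → ℝ)
    (t : ℝ) (ξ : Stt n) (μ : Stt m) : ℝ :=
  Filter.limsup (fun d : ℝ => (V (t + d) (ξ + d • f t ξ μ) - V t ξ) / d)
    (nhdsWithin 0 (Set.Ioi 0))

/-- Carathéodory function `[0,∞) × [0,∞) → ℝ`. -/
def Caratheodory2 (φ : ℝ → ℝ → ℝ) : Prop :=
  (∀ r : ℝ, Measurable fun t => φ t r) ∧
  (∀ t : ℝ, ContinuousOn (φ t) (Set.Ici 0)) ∧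
  ∀ a b c : ℝ, ∃ mK : ℝ → ℝ, MeasureTheory.IntegrableOn mK (Set.Icc a b) ∧
    ∀ t ∈ Set.Icc a b, ∀ r ∈ Set.Icc (0 : ℝ) c, |φ t r| ≤ mK t

/-- Assumption 1 of the paper, with all the data explicit. -/
def Assumption1 {n m : ℕ} {Λ : Type*} (γ : Λ → Set ℝ)
    (f g : Λ → ℝ → Stt n → Stt m → Stt n) (h0 h : ℝ → Stt n → ℝ)
    (V Vm : Λ → ℝ → Stt n → ℝ) (φ1 φ2 χ π : ℝ → ℝ)
    (vφ al : Λ → ℝ → ℝ → ℝ) : Prop :=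
  ClassKInf φ1 ∧ ClassKInf φ2 ∧ ClassKInf χ ∧ ClassKInf π ∧
  (∀ l : Λ, InClassV (γ l) (V l) (Vm l)) ∧
  (∀ l : Λ, Caratheodory2 (vφ l)) ∧
  (∀ (l : Λ) (t r : ℝ), 0 ≤ t → 0 ≤ r → 0 ≤ al l t r) ∧
  (∀ (l : Λ) (t : ℝ) (ξ : Stt n), 0 ≤ t →
    φ1 (h t ξ) ≤ V l t ξ ∧ V l t ξ ≤ φ2 (h0 t ξ)) ∧
  (∀ (l : Λ) (t : ℝ) (ξ : Stt n) (μ : Stt m), 0 ≤ t → t ∉ γ l → χ ‖μ‖ ≤ V l t ξ →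
    DiniAlong (f l) (V l) t ξ μ ≤ - vφ l t (V l t ξ)) ∧
  (∀ (l : Λ) (t : ℝ) (ξ : Stt n) (μ : Stt m), t ∈ γ l → χ ‖μ‖ ≤ Vm l t ξ →
    V l t (ξ + g l t ξ μ) ≤ al l t (Vm l t ξ)) ∧
  (∀ (l : Λ) (t : ℝ) (ξ : Stt n) (μ : Stt m), t ∈ γ l → Vm l t ξ ≤ χ ‖μ‖ →
    V l t (ξ + g l t ξ μ) ≤ π ‖μ‖)

/-- Solution of the scalar comparison differential/difference inclusion. -/
structure IsCompSol (γ : Set ℝ) (vφ al : ℝ → ℝ → ℝ) (t0 z0 : ℝ) (T : EReal)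
    (z : ℝ → ℝ) : Prop where
  lt : (t0 : EReal) < T
  init : z t0 = z0
  nonneg : ∀ t : ℝ, t0 ≤ t → (t : EReal) < T → 0 ≤ z t
  flow : ∀ t1 t2 : ℝ, t0 ≤ t1 → t1 ≤ t2 → (t2 : EReal) < T → Set.Ioc t1 t2 ∩ γ = ∅ →
    ∃ d : ℝ → ℝ, MeasureTheory.IntegrableOn d (Set.Icc t1 t2) ∧
      (∀ᵐ s ∂MeasureTheory.volume, s ∈ Set.Icc t1 t2 → d s ≤ - vφ s (z s)) ∧
      ∀ t ∈ Set.Icc t1 t2, z t = z t1 + ∫ s in t1..t, d s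
  jump : ∀ t ∈ γ, t0 < t → (t : EReal) < T →
    ∃ L : ℝ, Filter.Tendsto z (nhdsWithin t (Set.Iio t)) (nhds L) ∧ z t ≤ al t L

/-- The family of comparison systems is weakly GUAS. -/
def CompWeakGUAS {Λ : Type*} (γ : Λ → Set ℝ) (vφ al : Λ → ℝ → ℝ → ℝ) : Prop :=
  ∃ β : ℝ → ℝ → ℝ, ClassKL β ∧
    ∀ (l : Λ) (t0 z0 : ℝ) (T : EReal) (z : ℝ → ℝ), 0 ≤ t0 → 0 ≤ z0 →
      IsCompSol (γ l) (vφ l) (al l) t0 z0 T z →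
      ∀ t : ℝ, t0 ≤ t → (t : EReal) < T → z t ≤ β z0 (t - t0)

/-- The family of comparison systems is strongly GUAS. -/
def CompStrongGUAS {Λ : Type*} (γ : Λ → Set ℝ) (vφ al : Λ → ℝ → ℝ → ℝ) : Prop :=
  ∃ β : ℝ → ℝ → ℝ, ClassKL β ∧
    ∀ (l : Λ) (t0 z0 : ℝ) (T : EReal) (z : ℝ → ℝ), 0 ≤ t0 → 0 ≤ z0 →
      IsCompSol (γ l) (vφ l) (al l) t0 z0 T z →
      ∀ t : ℝ, t0 ≤ t → (t : EReal) < T → z t ≤ β z0 (t - t0 + (nJumps (γ l) t0 t : ℝ))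

/-- Nonnegative Carathéodory solution of the scalar ODE `ẇ = rhs(t,w)` on `[t0,T)`. -/
structure IsODESol (rhs : ℝ → ℝ → ℝ) (t0 : ℝ) (T : EReal) (w : ℝ → ℝ) : Prop where
  lt : (t0 : EReal) < T
  nonneg : ∀ t : ℝ, t0 ≤ t → (t : EReal) < T → 0 ≤ w t
  flow : ∀ t1 t2 : ℝ, t0 ≤ t1 → t1 ≤ t2 → (t2 : EReal) < T →
    IntervalIntegrable (fun s => rhs s (w s)) MeasureTheory.volume t1 t2 ∧
    w t2 = w t1 + ∫ s in t1..t2, rhs s (w s)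

/-- Maximally defined forward-in-time solution of `ẇ = rhs(t,w)`. -/
def IsMaxODESol (rhs : ℝ → ℝ → ℝ) (t0 : ℝ) (T : EReal) (w : ℝ → ℝ) : Prop :=
  IsODESol rhs t0 T w ∧
    ∀ (T' : EReal) (w' : ℝ → ℝ), IsODESol rhs t0 T' w' →
      (∀ t : ℝ, t0 ≤ t → (t : EReal) < T → w' t = w t) → T' ≤ T

/-- GUAS of the family of scalar ODEs `ẇ = −φ_λ(t,w)`. -/
def ODEFamilyGUAS {Λ : Type*} (vφ : Λ → ℝ → ℝ → ℝ) : Prop :=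
  ∃ β : ℝ → ℝ → ℝ, ClassKL β ∧
    ∀ (l : Λ) (t0 : ℝ) (T : EReal) (w : ℝ → ℝ), 0 ≤ t0 →
      IsMaxODESol (fun s r => -(vφ l s r)) t0 T w →
      T = (⊤ : EReal) ∧ ∀ t : ℝ, t0 ≤ t → w t ≤ β (w t0) (t - t0)

/-- Solution (on all of `[0,∞)`) of the scalar linear ODE `ẇ = −p(t)·w`. -/
def IsLinSol (p : ℝ → ℝ) (w : ℝ → ℝ) : Prop :=
  ∀ t1 t2 : ℝ, 0 ≤ t1 → t1 ≤ t2 →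
    IntervalIntegrable (fun s => p s * w s) MeasureTheory.volume t1 t2 ∧
    w t2 = w t1 + ∫ s in t1..t2, -(p s * w s)

/-- An impulsive and switching sequence, described through its impulse-time set,
its two switching signals (constant between impulses), and the left limit of the
first switching signal at impulse times. -/
structure SwSignal (Ic Id : Type*) where
  γ : Set ℝ
  σ1 : ℝ → Ic
  σ1m : ℝ → Ic
  σ2 : ℝ → Id
  impulse : IsImpulseSeq γ
  const1 : ∀ a b : ℝ, 0 ≤ a → Set.Ioo a b ∩ γ = ∅ → ∀ t ∈ Set.Ico a b, σ1 t = σ1 a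
  const2 : ∀ a b : ℝ, 0 ≤ a → Set.Ioo a b ∩ γ = ∅ → ∀ t ∈ Set.Ico a b, σ2 t = σ2 a
  leftlim : ∀ t ∈ γ, ∀ᶠ s in nhdsWithin t (Set.Iio t), σ1 s = σ1m t

/-- `σ ∈ SW(J)`. -/
def InSW {Ic Id : Type*} (σ : SwSignal Ic Id) (J : Set (Ic × Ic × Id)) : Prop :=
  ∀ t ∈ σ.γ, (σ.σ1m t, σ.σ1 t, σ.σ2 t) ∈ J

/-- Flow map of the switched impulsive system `Σ_σ`. -/
def swF {n m : ℕ} {Ic Id : Type*} (F : Ic → ℝ → Stt n → Stt m → Stt n)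
    (σ : SwSignal Ic Id) : ℝ → Stt n → Stt m → Stt n :=
  fun t ξ μ => F (σ.σ1 t) t ξ μ

/-- Jump map of the switched impulsive system `Σ_σ`. -/
def swG {n m : ℕ} {Ic Id : Type*} (G : Id → ℝ → Stt n → Stt m → Stt n)
    (σ : SwSignal Ic Id) : ℝ → Stt n → Stt m → Stt n :=
  fun t ξ μ => G (σ.σ2 t) t ξ μ

/-- Weak `(h⁰,h)`-ISS of the family `{Σ_σ}_{σ ∈ SW}`. -/
def SwWeaklyISS {n m : ℕ} {Ic Id : Type*} (F : Ic → ℝ → Stt n → Stt m → Stt n)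
    (G : Id → ℝ → Stt n → Stt m → Stt n) (SW : Set (SwSignal Ic Id))
    (h0 h : ℝ → Stt n → ℝ) : Prop :=
  ∃ β : ℝ → ℝ → ℝ, ∃ ρ : ℝ → ℝ, ClassKL β ∧ ClassKInf ρ ∧
    ∀ σ ∈ SW, ∀ (t0 : ℝ) (x0 : Stt n) (u : ℝ → Stt m) (T : EReal) (x : ℝ → Stt n),
      0 ≤ t0 → IsInput u → IsMaxSolution σ.γ (swF F σ) (swG G σ) t0 x0 u T x →
      ∀ t : ℝ, t0 ≤ t → (t : EReal) < T →
        h t (x t) ≤ β (h0 t0 x0) (t - t0) + ρ (inputNorm σ.γ u (Set.Ioc t0 t))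

/-- Strong `(h⁰,h)`-ISS of the family `{Σ_σ}_{σ ∈ SW}`. -/
def SwStronglyISS {n m : ℕ} {Ic Id : Type*} (F : Ic → ℝ → Stt n → Stt m → Stt n)
    (G : Id → ℝ → Stt n → Stt m → Stt n) (SW : Set (SwSignal Ic Id))
    (h0 h : ℝ → Stt n → ℝ) : Prop :=
  ∃ β : ℝ → ℝ → ℝ, ∃ ρ : ℝ → ℝ, ClassKL β ∧ ClassKInf ρ ∧
    ∀ σ ∈ SW, ∀ (t0 : ℝ) (x0 : Stt n) (u : ℝ → Stt m) (T : EReal) (x : ℝ → Stt n),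
      0 ≤ t0 → IsInput u → IsMaxSolution σ.γ (swF F σ) (swG G σ) t0 x0 u T x →
      ∀ t : ℝ, t0 ≤ t → (t : EReal) < T →
        h t (x t) ≤ β (h0 t0 x0) (t - t0 + (nJumps σ.γ t0 t : ℝ)) +
          ρ (inputNorm σ.γ u (Set.Ioc t0 t))

/-- Total activation time in `(t0,t]` of the flow modes in `A`. -/
def actT {Ic Id : Type*} (σ : SwSignal Ic Id) (A : Set Ic) (t0 t : ℝ) : ℝ :=
  (MeasureTheory.volume {r : ℝ | r ∈ Set.Ioc t0 t ∧ σ.σ1 r ∈ A}).toReal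

/-- Number of impulse times in `(t0,t]` whose mode combination lies in `Jp`. -/
def nJumpsIn {Ic Id : Type*} (σ : SwSignal Ic Id) (Jp : Set (Ic × Ic × Id))
    (t0 t : ℝ) : ℕ :=
  (σ.γ ∩ Set.Ioc t0 t ∩ {r : ℝ | (σ.σ1m r, σ.σ1 r, σ.σ2 r) ∈ Jp}).ncard

/-- Assumption 2 of the paper (for switched impulsive systems), data explicit. -/
def Assumption2 {n m : ℕ} {Ic Id : Type*}
    (F : Ic → ℝ → Stt n → Stt m → Stt n) (G : Id → ℝ → Stt n → Stt m → Stt n)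
    (h0 h : ℝ → Stt n → ℝ) (J : Set (Ic × Ic × Id))
    (v : Ic → ℝ → Stt n → ℝ) (φ1 φ2 χ π : ℝ → ℝ)
    (vφ : Ic → ℝ → ℝ → ℝ) (al : Ic × Ic × Id → ℝ → ℝ → ℝ) : Prop :=
  ClassKInf φ1 ∧ ClassKInf φ2 ∧ ClassKInf χ ∧ ClassKInf π ∧
  (∀ i : Ic, LocLipschitzOn ((Set.Ici (0 : ℝ)) ×ˢ (Set.univ : Set (Stt n)))
      (fun q : ℝ × Stt n => v i q.1 q.2)) ∧
  (∀ i : Ic, Caratheodory2 (vφ i)) ∧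
  (∀ e ∈ J, ∀ t r : ℝ, 0 ≤ t → 0 ≤ r → 0 ≤ al e t r) ∧
  (∀ (i : Ic) (t : ℝ) (ξ : Stt n), 0 ≤ t →
    φ1 (h t ξ) ≤ v i t ξ ∧ v i t ξ ≤ φ2 (h0 t ξ)) ∧
  (∀ (i : Ic) (t : ℝ) (ξ : Stt n) (μ : Stt m), 0 ≤ t → χ ‖μ‖ ≤ v i t ξ →
    DiniAlong (F i) (v i) t ξ μ ≤ - vφ i t (v i t ξ)) ∧
  (∀ (ι i : Ic) (j : Id), (ι, i, j) ∈ J → ∀ (t : ℝ) (ξ : Stt n) (μ : Stt m),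
    0 ≤ t → χ ‖μ‖ ≤ v ι t ξ → v i t (ξ + G j t ξ μ) ≤ al (ι, i, j) t (v ι t ξ)) ∧
  (∀ (ι i : Ic) (j : Id), (ι, i, j) ∈ J → ∀ (t : ℝ) (ξ : Stt n) (μ : Stt m),
    0 ≤ t → v ι t ξ ≤ χ ‖μ‖ → v i t (ξ + G j t ξ μ) ≤ π ‖μ‖)

/-- A positive definite function has a reciprocal integrable on compact subintervals
of `(0,∞)`. -/
lemma PosDef.intervalIntegrable_inv {φ : ℝ → ℝ} (hφ : PosDef φ) {a b : ℝ} (ha : 0 < a)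
    (hb : 0 < b) : IntervalIntegrable (fun s => (φ s)⁻¹) volume a b := by
  have hpos : ∀ x ∈ uIcc a b, 0 < x := fun x hx => (lt_min ha hb).trans_le hx.1
  exact ((hφ.1.mono fun x hx => (hpos x hx).le).inv₀
    fun x hx => (hφ.2.2 x (hpos x hx)).ne').intervalIntegrable

lemma PosDef.integral_inv_pos {φ : ℝ → ℝ} (hφ : PosDef φ) {a b : ℝ} (ha : 0 < a)
    (hab : a < b) : 0 < ∫ s in a..b, (φ s)⁻¹ :=
  intervalIntegral.intervalIntegral_pos_of_pos_on
    (hφ.intervalIntegrable_inv ha (ha.trans hab))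
    (fun x hx => inv_pos.2 (hφ.2.2 x (ha.trans hx.1))) hab

/-- The primitive `∫ ds/φ(s)` of the reciprocal of `φ` in the logarithmic variable. -/
def logPrimitive (φ : ℝ → ℝ) (y : ℝ) : ℝ := ∫ s in (1 : ℝ)..Real.exp y, (φ s)⁻¹

lemma PosDef.logPrimitive_sub {φ : ℝ → ℝ} (hφ : PosDef φ) (x y : ℝ) :
    logPrimitive φ y - logPrimitive φ x = ∫ s in (Real.exp x)..(Real.exp y), (φ s)⁻¹ :=
  intervalIntegral.integral_interval_sub_left
    (hφ.intervalIntegrable_inv one_pos (Real.exp_pos y))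
    (hφ.intervalIntegrable_inv one_pos (Real.exp_pos x))

lemma PosDef.strictMono_logPrimitive {φ : ℝ → ℝ} (hφ : PosDef φ) :
    StrictMono (logPrimitive φ) := fun x y hxy => by
  have := hφ.integral_inv_pos (Real.exp_pos x) (Real.exp_lt_exp.2 hxy)
  rw [← hφ.logPrimitive_sub] at this
  linarith

lemma PosDef.continuous_logPrimitive {φ : ℝ → ℝ} (hφ : PosDef φ) :
    Continuous (logPrimitive φ) := by
  refine continuous_iff_continuousAt.2 fun y => ?_
  have hcont : ContinuousOn (fun s => (φ s)⁻¹) (Ioi 0) :=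
    (hφ.1.mono Ioi_subset_Ici_self).inv₀ fun x hx => (hφ.2.2 x hx).ne'
  have hmem : Ioi (0 : ℝ) ∈ nhds (Real.exp y) := Ioi_mem_nhds (Real.exp_pos y)
  have hderiv := intervalIntegral.integral_hasDerivAt_right
    (hφ.intervalIntegrable_inv one_pos (Real.exp_pos y))
    (hcont.stronglyMeasurableAtFilter isOpen_Ioi _ (Real.exp_pos y))
    (hcont.continuousAt hmem)
  exact ContinuousAt.comp (f := Real.exp) (g := fun u => ∫ s in (1 : ℝ)..u, (φ s)⁻¹)
    hderiv.continuousAt Real.continuous_exp.continuousAt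

lemma PosDef.tendsto_logPrimitive_atTop {φ : ℝ → ℝ} (hφ : PosDef φ)
    (hdiv : ¬ IntegrableOn (fun s => (φ s)⁻¹) (Ici 1)) :
    Tendsto (logPrimitive φ) atTop atTop := by
  refine tendsto_atTop_atTop_of_monotone hφ.strictMono_logPrimitive.monotone fun M => ?_
  by_contra! h
  refine hdiv (integrableOn_Ici_iff_integrableOn_Ioi (by simp) |>.2 ?_)
  refine integrableOn_Ioi_of_intervalIntegral_norm_bounded M 1 (l := atTop) (b := Real.exp)
    (fun y => ?_) Real.tendsto_exp_atTop ?_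
  · rcases le_total 1 (Real.exp y) with hy | hy
    · exact (intervalIntegrable_iff_integrableOn_Ioc_of_le hy).1
        (hφ.intervalIntegrable_inv one_pos (Real.exp_pos y))
    · simp [Ioc_eq_empty_of_le hy]
  · filter_upwards [eventually_ge_atTop 0] with y hy
    refine le_trans (le_of_eq ?_) (h y).le
    refine intervalIntegral.integral_congr fun s hs => ?_
    rw [uIcc_of_le (Real.one_le_exp hy)] at hs
    exact Real.norm_of_nonneg (inv_pos.2 (hφ.2.2 s (one_pos.trans_le hs.1))).le

/-- If `α` decreases the primitive by a fixed amount, then `∫_0^1 ds/φ(s) = ∞`. -/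
lemma PosDef.tendsto_logPrimitive_atBot {φ α : ℝ → ℝ} (hφ : PosDef φ) (hα : PosDef α)
    {c : ℝ} (hc : 0 < c) (h : ∀ a, 0 < a → c ≤ ∫ s in (α a)..a, (φ s)⁻¹) :
    Tendsto (logPrimitive φ) atBot atBot := by
  have hstep : ∀ n : ℕ, ∃ y, logPrimitive φ y ≤ -(n * c) := fun n => by
    induction n with
    | zero => exact ⟨0, by simp [logPrimitive]⟩
    | succ n ih =>
      obtain ⟨y, hy⟩ := ih
      have hy' := h _ (Real.exp_pos y)
      rw [← Real.exp_log (hα.2.2 _ (Real.exp_pos y)), ← hφ.logPrimitive_sub] at hy'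
      refine ⟨Real.log (α (Real.exp y)), ?_⟩
      push_cast
      linarith
  refine tendsto_atBot_atBot_of_monotone hφ.strictMono_logPrimitive.monotone fun M => ?_
  obtain ⟨n, hn⟩ := exists_nat_gt (-M / c)
  obtain ⟨y, hy⟩ := hstep n
  rw [div_lt_iff₀ hc] at hn
  exact ⟨y, by linarith⟩

/-- If `α` decreases the primitive of `1/φ` by at least `c > 0`, then it has a `K∞` upper
bound which decreases it by exactly `c`. -/
lemma PosDef.exists_classKInf_integral_eq {φ α : ℝ → ℝ} (hφ : PosDef φ) (hα : PosDef α)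
    (hdiv : ¬ IntegrableOn (fun s => (φ s)⁻¹) (Ici 1))
    {c : ℝ} (hc : 0 < c) (h : ∀ a, 0 < a → c ≤ ∫ s in (α a)..a, (φ s)⁻¹) :
    ∃ αb : ℝ → ℝ, ClassKInf αb ∧ (∀ a : ℝ, 0 ≤ a → α a ≤ αb a) ∧
      ∀ a, 0 < a → ∫ s in (αb a)..a, (φ s)⁻¹ = c := by
  have hmono := hφ.strictMono_logPrimitive
  let e : ℝ ≃o ℝ := hmono.orderIsoOfSurjective _ (hφ.continuous_logPrimitive.surjective
    (hφ.tendsto_logPrimitive_atTop hdiv) (hφ.tendsto_logPrimitive_atBot hα hc h))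
  have he : ∀ y, e y = logPrimitive φ y := fun y => rfl
  let g : ℝ → ℝ := fun a => Real.exp (e.symm (e (Real.log a) - c))
  let αb : ℝ → ℝ := fun a => if 0 < a then g a else 0
  have hαb : ∀ a, 0 < a → αb a = g a := fun a ha => if_pos ha
  have hαb0 : αb 0 = 0 := if_neg (lt_irrefl _)
  have hg_pos : ∀ a, 0 < g a := fun a => Real.exp_pos _
  have hint : ∀ a, 0 < a → ∫ s in (αb a)..a, (φ s)⁻¹ = c := fun a ha => by
    have hsub := hφ.logPrimitive_sub (e.symm (e (Real.log a) - c)) (Real.log a)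
    rw [← he, ← he, e.apply_symm_apply, sub_sub_cancel, Real.exp_log ha] at hsub
    rw [hαb a ha, hsub]
  have hle : ∀ a, 0 < a → g a ≤ a := fun a ha => by
    conv_rhs => rw [← Real.exp_log ha]
    refine Real.exp_le_exp.2 (e.symm_apply_le.2 ?_)
    linarith
  have hstrict : StrictMonoOn αb (Ici 0) := fun a ha b hb hab => by
    have hb' : 0 < b := lt_of_le_of_lt ha hab
    rw [hαb b hb']
    rcases eq_or_lt_of_le (mem_Ici.1 ha) with rfl | ha'
    · rw [hαb0]
      exact hg_pos b
    · rw [hαb a ha']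
      exact Real.exp_lt_exp.2 (e.symm.strictMono
        (sub_lt_sub_right (e.strictMono (Real.log_lt_log ha' hab)) c))
  refine ⟨αb, ⟨?_, hstrict, hαb0, fun M => ?_⟩, fun a ha => ?_, hint⟩
  · intro a ha
    rcases eq_or_lt_of_le (mem_Ici.1 ha) with rfl | ha'
    · rw [ContinuousWithinAt, hαb0]
      refine tendsto_of_tendsto_of_tendsto_of_le_of_le' tendsto_const_nhds
        (tendsto_id.mono_left nhdsWithin_le_nhds) ?_ ?_
      · filter_upwards [self_mem_nhdsWithin] with x hx
        rw [← hαb0]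
        exact hstrict.monotoneOn self_mem_Ici hx hx
      · filter_upwards [self_mem_nhdsWithin] with x hx
        rcases eq_or_lt_of_le (mem_Ici.1 hx) with rfl | hx'
        · exact hαb0.le
        · exact (hαb x hx').trans_le (hle x hx')
    · have hg : ContinuousAt g a := Real.continuous_exp.continuousAt.comp
        (e.symm.continuous.continuousAt.comp
          ((e.continuous.continuousAt.comp (Real.continuousAt_log ha'.ne')).sub
            continuousAt_const))
      exact (hg.congr ((eventually_gt_nhds ha').mono
        fun x hx => (hαb x hx).symm)).continuousWithinAt
  · refine ⟨Real.exp (e.symm (e (Real.log (max M 1)) + c)), (Real.exp_pos _).le, ?_⟩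
    rw [hαb _ (Real.exp_pos _)]
    simp only [g, Real.log_exp, e.apply_symm_apply, add_sub_cancel_right,
      e.symm_apply_apply]
    rw [Real.exp_log (one_pos.trans_le (le_max_right M 1))]
    exact le_max_left M 1
  · rcases eq_or_lt_of_le ha with rfl | ha'
    · rw [hα.2.1, hαb0]
    · have hαa := hα.2.2 a ha'
      have hdec := hφ.logPrimitive_sub (Real.log (α a)) (Real.log a)
      rw [Real.exp_log hαa, Real.exp_log ha'] at hdec
      rw [hαb a ha', ← Real.log_le_iff_le_exp hαa, e.le_symm_apply, he, he]
      linarith [h a ha']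

/-- Lemma 2(b): the positive definite `α` can be replaced by a `K∞` upper
bound keeping the reverse integral condition. -/
theorem stmt16 (φ α p : ℝ → ℝ) (hφ : PosDef φ) (hα : PosDef α)
    (hp : LocIntegrable p) (hpnn : ∀ t : ℝ, 0 ≤ t → 0 ≤ p t)
    (θ : ℝ) (hθ : 0 < θ)
    (hdiv : ¬ MeasureTheory.IntegrableOn (fun s => (φ s)⁻¹) (Set.Ici 1))
    (hbddP : BddAbove ((fun t => ∫ s in t..(t + θ), p s) '' Set.Ici 0))
    (hgt : sSup ((fun t => ∫ s in t..(t + θ), p s) '' Set.Ici 0) <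
      sInf ((fun a => ∫ s in (α a)..a, (φ s)⁻¹) '' Set.Ioi 0)) :
    ∃ αb : ℝ → ℝ, ClassKInf αb ∧ (∀ a : ℝ, 0 ≤ a → α a ≤ αb a) ∧
      sSup ((fun t => ∫ s in t..(t + θ), p s) '' Set.Ici 0) <
        sInf ((fun a => ∫ s in (αb a)..a, (φ s)⁻¹) '' Set.Ioi 0) := by
  have hS : 0 ≤ sSup ((fun t => ∫ s in t..(t + θ), p s) '' Set.Ici 0) := by
    refine Real.sSup_nonneg ?_
    rintro _ ⟨t, ht, rfl⟩
    exact intervalIntegral.integral_nonneg (by linarith)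
      fun u hu => hpnn u (le_trans ht hu.1)
  have hbdd : BddBelow ((fun a => ∫ s in (α a)..a, (φ s)⁻¹) '' Set.Ioi 0) := by
    by_contra hb
    rw [Real.sInf_of_not_bddBelow hb] at hgt
    exact hgt.not_ge hS
  obtain ⟨αb, hK, hle, hint⟩ := hφ.exists_classKInf_integral_eq hα hdiv (hS.trans_lt hgt)
    fun a ha => csInf_le hbdd (mem_image_of_mem _ ha)
  refine ⟨αb, hK, hle, ?_⟩
  have himage : (fun a => ∫ s in (αb a)..a, (φ s)⁻¹) '' Set.Ioi 0 =
      {sInf ((fun a => ∫ s in (α a)..a, (φ s)⁻¹) '' Set.Ioi 0)} :=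
    (image_congr (s := Set.Ioi 0) fun a ha => hint a ha).trans (nonempty_Ioi.image_const _)
  rwa [himage, csInf_singleton]

end
end

section
/- Let φ̄ : [0,∞) → R be continuous with φ̄(0) = 0 and φ̄(r) < 0 for all r > 0, and assume ∫_1^∞ ds/(−φ̄(s)) = ∞ and lim_{r→0⁺} ∫_r^1 ds/(−φ̄(s)) = ∞. Define F : (0,∞) → R by F(r) = ∫_1^r ds/(−φ̄(s)), with inverse F⁻¹ : R → (0,∞). Let p : [0,∞) → [0,∞) be locally integrable, let θ > 0 and M* := sup_{t≥0} ∫_t^{t+θ} p(s) ds < ∞, and for t_0 ≥ 0 and ζ ≥ 0 let w(·,t_0,ζ) denote the unique forward-in-time solution of ẇ(t) = −p(t) φ̄(w(t)), w(t_0) = ζ. Let ᾱ be of class K∞ and suppose N* := inf_{a>0} ∫_{ᾱ(a)}^a ds/(−φ̄(s)) > M*. Define G(ζ) = F⁻¹(F(ᾱ(ζ)) + M*) for ζ > 0 and G(0) = 0. Then G is continuous, the function ζ ↦ ζ − G(ζ) is positive definite, and w(t,t_0,ᾱ(ζ)) ≤ G(ζ) for all t ∈ [t_0, t_0 + θ],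 all t_0 ≥ 0 and all ζ ≥ 0. -/
open MeasureTheory Filter Set
open scoped Classical

noncomputable section

theorem LipschitzOnWith.comp_absolutelyContinuousOnInterval {f g : ℝ → ℝ} {K : NNReal}
    {s : Set ℝ} {a b : ℝ} (hf : LipschitzOnWith K f s)
    (hg : AbsolutelyContinuousOnInterval g a b) (hgs : MapsTo g (uIcc a b) s) :
    AbsolutelyContinuousOnInterval (f ∘ g) a b := by
  rw [absolutelyContinuousOnInterval_iff] at hg ⊢
  intro ε hε
  obtain ⟨δ, hδ, h⟩ := hg (ε / (K + 1)) (by positivity)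
  refine ⟨δ, hδ, fun E hE hlt => ?_⟩
  calc ∑ i ∈ Finset.range E.1, dist ((f ∘ g) (E.2 i).1) ((f ∘ g) (E.2 i).2)
      ≤ ∑ i ∈ Finset.range E.1, K * dist (g (E.2 i).1) (g (E.2 i).2) :=
        Finset.sum_le_sum fun i hi =>
          hf.dist_le_mul _ (hgs (hE.1 i hi).1) _ (hgs (hE.1 i hi).2)
    _ = K * ∑ i ∈ Finset.range E.1, dist (g (E.2 i).1) (g (E.2 i).2) :=
        (Finset.mul_sum _ _ _).symm
    _ ≤ K * (ε / (K + 1)) := by gcongr; exact (h E hE hlt).le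
    _ < (K + 1) * (ε / (K + 1)) := by gcongr; linarith
    _ = ε := by field

theorem intervalIntegrable_inv_of_pos {k : ℝ → ℝ} (hk : ContinuousOn k (Ioi 0))
    (hk0 : ∀ r, 0 < r → 0 < k r) {a b : ℝ} (ha : 0 < a) (hb : 0 < b) :
    IntervalIntegrable (fun s => (k s)⁻¹) volume a b := by
  have hsub : uIcc a b ⊆ Ioi 0 := fun x hx => lt_of_lt_of_le (lt_min ha hb) hx.1
  exact ((hk.mono hsub).inv₀ fun x hx => (hk0 x (hsub hx)).ne').intervalIntegrable

theorem hasDerivAt_integral_inv {k : ℝ → ℝ} (hk : ContinuousOn k (Ioi 0))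
    (hk0 : ∀ r, 0 < r → 0 < k r) {r : ℝ} (hr : 0 < r) :
    HasDerivAt (fun x => ∫ s in (1 : ℝ)..x, (k s)⁻¹) (k r)⁻¹ r := by
  have hc : ContinuousOn (fun s => (k s)⁻¹) (Ioi 0) := hk.inv₀ fun x hx => (hk0 x hx).ne'
  exact intervalIntegral.integral_hasDerivAt_right
    (intervalIntegrable_inv_of_pos hk hk0 one_pos hr)
    (hc.stronglyMeasurableAtFilter isOpen_Ioi r hr) (hc.continuousAt (Ioi_mem_nhds hr))

theorem strictMonoOn_integral_inv {k : ℝ → ℝ} (hk : ContinuousOn k (Ioi 0))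
    (hk0 : ∀ r, 0 < r → 0 < k r) :
    StrictMonoOn (fun x => ∫ s in (1 : ℝ)..x, (k s)⁻¹) (Ioi 0) := by
  refine strictMonoOn_of_deriv_pos (convex_Ioi 0)
    (fun x hx => (hasDerivAt_integral_inv hk hk0 hx).continuousAt.continuousWithinAt) ?_
  intro x hx
  rw [interior_Ioi] at hx
  rw [(hasDerivAt_integral_inv hk hk0 hx).deriv]
  exact inv_pos.2 (hk0 x hx)

/-- Separation of variables for a positive Carathéodory solution of `ẇ = p(t)·k(w)`. -/
theorem integral_inv_eq_of_separable {k p w : ℝ → ℝ} (hk : ContinuousOn k (Ioi 0))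
    (hk0 : ∀ r, 0 < r → 0 < k r) {a b : ℝ} (hab : a ≤ b)
    (hp : IntervalIntegrable p volume a b)
    (hg : IntervalIntegrable (fun s => p s * k (w s)) volume a b)
    (hw : ∀ t ∈ Icc a b, w t = w a + ∫ s in a..t, p s * k (w s))
    (hpos : ∀ t ∈ Icc a b, 0 < w t) :
    ∫ s in (1 : ℝ)..(w b), (k s)⁻¹ = (∫ s in (1 : ℝ)..(w a), (k s)⁻¹) + ∫ s in a..b, p s := by
  set F : ℝ → ℝ := fun x => ∫ s in (1 : ℝ)..x, (k s)⁻¹ with hF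
  set W : ℝ → ℝ := fun t => w a + ∫ s in a..t, p s * k (w s) with hW
  have hI : uIcc a b = Icc a b := uIcc_of_le hab
  have hWw : ∀ t ∈ Icc a b, W t = w t := fun t ht => (hw t ht).symm
  have hWac : AbsolutelyContinuousOnInterval W a b :=
    (LipschitzWith.const (w a)).lipschitzOnWith.absolutelyContinuousOnInterval.fun_add
      (hg.absolutelyContinuousOnInterval_intervalIntegral left_mem_uIcc)
  have hcomp : IsCompact (W '' Icc a b) :=
    isCompact_Icc.image_of_continuousOn (hI ▸ hWac.continuousOn)
  have hne : (W '' Icc a b).Nonempty := ⟨_, mem_image_of_mem W (left_mem_Icc.2 hab)⟩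
  obtain ⟨m, hm, hmin⟩ := hcomp.exists_isLeast hne
  obtain ⟨M, -, hmax⟩ := hcomp.exists_isGreatest hne
  have hm0 : 0 < m := by
    obtain ⟨t, ht, rfl⟩ := hm
    rw [hWw t ht]
    exact hpos t ht
  have hsub : Icc m M ⊆ Ioi 0 := fun x hx => hm0.trans_le hx.1
  obtain ⟨C, hC⟩ := isCompact_Icc.exists_bound_of_continuousOn
    ((hk.mono hsub).inv₀ fun x hx => (hk0 x (hsub hx)).ne')
  have hlip : LipschitzOnWith C.toNNReal F (Icc m M) := by
    refine (convex_Icc m M).lipschitzOnWith_of_nnnorm_hasDerivWithin_le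
      (fun x hx => (hasDerivAt_integral_inv hk hk0 (hsub hx)).hasDerivWithinAt) fun x hx => ?_
    rw [← NNReal.coe_le_coe, coe_nnnorm]
    exact (hC x hx).trans (Real.le_coe_toNNReal C)
  have hFW : AbsolutelyContinuousOnInterval (F ∘ W) a b := by
    refine hlip.comp_absolutelyContinuousOnInterval hWac fun t ht => ?_
    rw [hI] at ht
    exact ⟨hmin (mem_image_of_mem W ht), hmax (mem_image_of_mem W ht)⟩
  have hD := hFW.sub (hp.absolutelyContinuousOnInterval_intervalIntegral left_mem_uIcc)
  obtain ⟨c, hc⟩ := hD.const_of_ae_hasDerivAt_zero (by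
    filter_upwards [hg.ae_hasDerivAt_integral, hp.ae_hasDerivAt_integral] with x hx₁ hx₂ hx
    have hxI : x ∈ Icc a b := hI ▸ hx
    have hWx : HasDerivAt W (p x * k (w x)) x := (hx₁ hx a left_mem_uIcc).const_add (w a)
    have hwx := hpos x hxI
    have hFx : HasDerivAt F (k (w x))⁻¹ (W x) := by
      rw [hWw x hxI]
      exact hasDerivAt_integral_inv hk hk0 hwx
    convert! (hFx.comp x hWx).sub (hx₂ hx a left_mem_uIcc) using 1
    have := (hk0 _ hwx).ne'
    field_simp
    ring)
  have h := (hc b right_mem_uIcc).trans (hc a left_mem_uIcc).symm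
  simp only [Pi.sub_apply, Function.comp_apply, intervalIntegral.integral_same,
    hWw b (right_mem_Icc.2 hab), hWw a (left_mem_Icc.2 hab)] at h
  linarith

/-- Claim 2 in the proof of Theorem 6: properties of `G` and the one-period
bound `w(t,t0,ᾱ(ζ)) ≤ G(ζ)` for the scalar ODE `ẇ = −p(t)·φ̄(w)`. -/
theorem stmt18 (φb : ℝ → ℝ) (hφbc : ContinuousOn φb (Set.Ici 0)) (hφb0 : φb 0 = 0)
    (hφbneg : ∀ r : ℝ, 0 < r → φb r < 0)
    (hdiv1 : ¬ MeasureTheory.IntegrableOn (fun s => (-(φb s))⁻¹) (Set.Ici 1))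
    (hdiv0 : ¬ MeasureTheory.IntegrableOn (fun s => (-(φb s))⁻¹) (Set.Ioc 0 1))
    (F : ℝ → ℝ) (hF : ∀ r : ℝ, F r = ∫ s in (1 : ℝ)..r, (-(φb s))⁻¹)
    (Finv : ℝ → ℝ) (hFinv1 : ∀ r : ℝ, 0 < r → Finv (F r) = r)
    (hFinv2 : ∀ y : ℝ, 0 < Finv y ∧ F (Finv y) = y)
    (p : ℝ → ℝ) (hp : LocIntegrable p) (hpnn : ∀ t : ℝ, 0 ≤ t → 0 ≤ p t)
    (θ : ℝ) (hθ : 0 < θ)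
    (Mstar : ℝ) (hMs : Mstar = sSup ((fun t => ∫ s in t..(t + θ), p s) '' Set.Ici 0))
    (hMfin : BddAbove ((fun t => ∫ s in t..(t + θ), p s) '' Set.Ici 0))
    (αb : ℝ → ℝ) (hαb : ClassKInf αb)
    (hN : Mstar < sInf ((fun a => ∫ s in (αb a)..a, (-(φb s))⁻¹) '' Set.Ioi 0))
    (Gf : ℝ → ℝ) (hG0 : Gf 0 = 0)
    (hGpos : ∀ ζ : ℝ, 0 < ζ → Gf ζ = Finv (F (αb ζ) + Mstar)) :
    ContinuousOn Gf (Set.Ici 0) ∧ PosDef (fun ζ => ζ - Gf ζ) ∧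
    ∀ t0 ζ : ℝ, 0 ≤ t0 → 0 ≤ ζ →
      ∀ (T : EReal) (w : ℝ → ℝ), IsODESol (fun s r => -(p s * φb r)) t0 T w →
        w t0 = αb ζ →
        ∀ t : ℝ, t0 ≤ t → t ≤ t0 + θ → (t : EReal) < T → w t ≤ Gf ζ := by
  have hk : ContinuousOn (fun s => -(φb s)) (Ioi 0) := (hφbc.mono Ioi_subset_Ici_self).neg
  have hk0 : ∀ r : ℝ, 0 < r → 0 < -(φb r) := fun r hr => neg_pos.2 (hφbneg r hr)
  have hFeq : F = fun r => ∫ s in (1 : ℝ)..r, (-(φb s))⁻¹ := funext hF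
  have hFmono : StrictMonoOn F (Ioi 0) := hFeq ▸ strictMonoOn_integral_inv hk hk0
  have hFcont : ∀ r, 0 < r → ContinuousAt F r := fun r hr =>
    hFeq ▸ (hasDerivAt_integral_inv hk hk0 hr).continuousAt
  have hpI : ∀ a b, IntervalIntegrable p volume a b := fun a b =>
    intervalIntegrable_iff.2 ((hp (min a b) (max a b)).mono_set Ioc_subset_Icc_self)
  have hpint : ∀ a b, 0 ≤ a → a ≤ b → 0 ≤ ∫ s in a..b, p s := fun a b ha hab =>
    intervalIntegral.integral_nonneg hab fun u hu => hpnn u (ha.trans hu.1)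
  have hpM : ∀ t, 0 ≤ t → ∫ s in t..(t + θ), p s ≤ Mstar := fun t ht =>
    hMs ▸ le_csSup hMfin (mem_image_of_mem _ ht)
  have hM0 : 0 ≤ Mstar := (hpint 0 (0 + θ) le_rfl (by linarith)).trans (hpM 0 le_rfl)
  obtain ⟨hαc, hαm, hα0, -⟩ := hαb
  have hαpos : ∀ ζ, 0 < ζ → 0 < αb ζ := fun ζ hζ => by
    simpa [hα0] using hαm self_mem_Ici hζ.le hζ
  have hbdd : BddBelow ((fun a => ∫ s in (αb a)..a, (-(φb s))⁻¹) '' Ioi 0) := by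
    by_contra h
    rw [Real.sInf_of_not_bddBelow h] at hN
    exact hN.not_ge hM0
  have hgap : ∀ ζ, 0 < ζ → F (αb ζ) + Mstar < F ζ := fun ζ hζ => by
    have h1 := hN.trans_le (csInf_le hbdd (mem_image_of_mem _ hζ))
    have h2 := intervalIntegral.integral_interval_sub_left
      (intervalIntegrable_inv_of_pos hk hk0 one_pos hζ)
      (intervalIntegrable_inv_of_pos hk hk0 one_pos (hαpos ζ hζ))
    simp only [hF] at h1 h2 ⊢
    linarith
  have hFinvmono : StrictMono Finv := fun x y hxy => by
    refine (hFmono.lt_iff_lt (hFinv2 x).1 (hFinv2 y).1).1 ?_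
    rwa [(hFinv2 x).2, (hFinv2 y).2]
  have hFinvc : Continuous Finv := continuous_iff_continuousAt.2 fun y => by
    refine (hFinvmono.strictMonoOn univ).continuousAt_of_image_mem_nhds univ_mem ?_
    filter_upwards [Ioi_mem_nhds (hFinv2 y).1] with r hr
    exact ⟨F r, mem_univ _, hFinv1 r hr⟩
  have hGlt : ∀ ζ, 0 < ζ → Gf ζ < ζ := fun ζ hζ => by
    rw [hGpos ζ hζ]
    simpa [hFinv1 ζ hζ] using hFinvmono (hgap ζ hζ)
  have hG_nonneg : ∀ ζ, 0 ≤ ζ → 0 ≤ Gf ζ := fun ζ hζ => by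
    rcases hζ.eq_or_lt with rfl | h
    · exact hG0.ge
    · rw [hGpos ζ h]
      exact (hFinv2 _).1.le
  have hGc : ContinuousOn Gf (Ici 0) := by
    intro ζ hζ
    rcases (mem_Ici.1 hζ).eq_or_lt with rfl | h
    · rw [ContinuousWithinAt, hG0]
      refine tendsto_of_tendsto_of_tendsto_of_le_of_le' tendsto_const_nhds
        (tendsto_id'.2 nhdsWithin_le_nhds) ?_ ?_
      · filter_upwards [self_mem_nhdsWithin] with x hx using hG_nonneg x hx
      · filter_upwards [self_mem_nhdsWithin] with x hx
        rcases (mem_Ici.1 hx).eq_or_lt with rfl | hx0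
        · exact hG0.le
        · exact (hGlt x hx0).le
    · refine ContinuousAt.continuousWithinAt (ContinuousAt.congr
        (f := fun ζ => Finv (F (αb ζ) + Mstar)) ?_ ?_)
      · exact hFinvc.continuousAt.comp
          (((hFcont _ (hαpos ζ h)).comp (hαc.continuousAt (Ici_mem_nhds h))).add_const Mstar)
      · filter_upwards [Ioi_mem_nhds h] with x hx using (hGpos x hx).symm
  refine ⟨hGc, ⟨continuousOn_id.sub hGc, by simp [hG0], fun r hr => sub_pos.2 (hGlt r hr)⟩, ?_⟩
  intro t0 ζ ht0 hζ T w hw hwt0 t ht htθ htT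
  have hflow : ∀ t1 t2, t0 ≤ t1 → t1 ≤ t2 → t2 ≤ t →
      IntervalIntegrable (fun s => p s * -(φb (w s))) volume t1 t2 ∧
      w t2 = w t1 + ∫ s in t1..t2, p s * -(φb (w s)) := fun t1 t2 h1 h2 h3 => by
    simpa only [mul_neg] using
      hw.flow t1 t2 h1 h2 ((EReal.coe_le_coe_iff.2 h3).trans_lt htT)
  have hwnn : ∀ s, t0 ≤ s → s ≤ t → 0 ≤ w s := fun s h1 h2 =>
    hw.nonneg s h1 ((EReal.coe_le_coe_iff.2 h2).trans_lt htT)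
  have hwmono : ∀ t1 t2, t0 ≤ t1 → t1 ≤ t2 → t2 ≤ t → w t1 ≤ w t2 := fun t1 t2 h1 h2 h3 => by
    rw [(hflow t1 t2 h1 h2 h3).2, le_add_iff_nonneg_right]
    refine intervalIntegral.integral_nonneg h2 fun u hu => mul_nonneg
      (hpnn u (ht0.trans (h1.trans hu.1))) ?_
    rcases (hwnn u (h1.trans hu.1) (hu.2.trans h3)).eq_or_lt with h | h
    · simp [← h, hφb0]
    · exact (hk0 _ h).le
  have hgrowth : ∀ s, t0 ≤ s → s ≤ t → 0 < w s → F (w t) ≤ F (w s) + Mstar :=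
    fun s h1 h2 hs => by
      have h := integral_inv_eq_of_separable hk hk0 h2 (hpI s t) (hflow s t h1 h2 le_rfl).1
        (fun u hu => (hflow s u h1 hu.1 hu.2).2)
        (fun u hu => hs.trans_le (hwmono s u h1 hu.1 hu.2))
      have hsM : ∫ u in s..t, p u ≤ Mstar := by
        refine le_trans ?_ (hpM t0 ht0)
        rw [← intervalIntegral.integral_add_adjacent_intervals (hpI t0 s) (hpI s (t0 + θ)),
          ← intervalIntegral.integral_add_adjacent_intervals (hpI s t) (hpI t (t0 + θ))]
        linarith [hpint t0 s ht0 h1, hpint t (t0 + θ) (ht0.trans ht) htθ]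
      rw [hF, hF, h]
      linarith
  rcases hζ.eq_or_lt with rfl | hζ0
  · rw [hG0]
    by_contra! hwt
    rw [hα0] at hwt0
    have hwc : ContinuousOn w (Icc t0 t) := by
      have hc := intervalIntegral.continuousOn_primitive_interval'
        (hflow t0 t le_rfl ht le_rfl).1 left_mem_uIcc
      rw [uIcc_of_le ht] at hc
      exact (hc.const_add (w t0)).congr fun s hs => (hflow t0 s le_rfl hs.1 hs.2).2
    set r := Finv (F (w t) - Mstar - 1)
    have hr : 0 < r ∧ F r = F (w t) - Mstar - 1 := hFinv2 _
    obtain ⟨s, hs, hws⟩ := intermediate_value_Icc ht hwc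
      (show min r (w t) ∈ Icc (w t0) (w t) from
        ⟨hwt0 ▸ (lt_min hr.1 hwt).le, min_le_right _ _⟩)
    have hspos : 0 < w s := hws ▸ lt_min hr.1 hwt
    have h1 := hgrowth s hs.1 hs.2 hspos
    have h2 : F (w s) ≤ F r := hFmono.monotoneOn hspos hr.1 (hws ▸ min_le_left _ _)
    linarith [hr.2]
  · have hα := hαpos ζ hζ0
    have hwpos : 0 < w t := (hwt0 ▸ hα).trans_le (hwmono t0 t le_rfl ht le_rfl)
    have h := hgrowth t0 le_rfl ht (hwt0 ▸ hα)
    rw [hwt0] at h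
    rw [hGpos ζ hζ0, ← hFinv1 (w t) hwpos]
    exact hFinvmono.monotone h

end
end
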